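/- arXiv:1404.1782 — 2 statements merged into one kernel-verified Lean document; each statement's English description precedes it below -/
import Mathlib

section
/- Fix reals t, v*, p̃ with t > 0, and write Δq = q_NN − q_N. If (q_N, q_NN) is a maximizer of π_G over the feasible set, then at least one of the following four conditions holds: (1) −5Δq ≤ p̃ ≤ Δq and q_NN = v* − t/2 + (Δq − p̃)/6; (2) p̃ ≤ min{Δq, −5Δq} and q_N = v* − t/2; (3) p̃ ≥ max{Δq, −5Δq} and q_NN = v* − t/2; (4) Δq ≤ p̃ ≤ −5Δq and q_N = v* − t/2 − (Δq − p̃)/6. -/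
/-- Content provider's stage-2 payoff. -/
noncomputable def piG (t ptil qN qNN : ℝ) : ℝ :=
  (qNN - ptil) * (1 / 2 - (qNN - qN - ptil) / (6 * t)) +
    qN * (1 / 2 + (qNN - qN - ptil) / (6 * t))

/-- Full-coverage feasibility constraints for the content provider. -/
def Feasible (t vstar ptil qN qNN : ℝ) : Prop :=
  (qNN - qN ≥ ptil →
    qN ≤ vstar - t / 2 ∧ qNN ≤ vstar - t / 2 + (qNN - qN - ptil) / 6) ∧
  (qNN - qN ≤ ptil →
    qNN ≤ vstar - t / 2 ∧ qN ≤ vstar - t / 2 - (qNN - qN - ptil) / 6)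

/-- Raising both fees by `d` raises the payoff by `d`, since the market shares sum to one. -/
theorem piG_add_add (t ptil qN qNN d : ℝ) :
    piG t ptil (qN + d) (qNN + d) = piG t ptil qN qNN + d := by
  unfold piG
  rw [add_sub_add_right_eq_sub]
  ring

/-- Any maximizer of `π_G` over the feasible set lies in one of four candidate sets. -/
theorem four_candidate_sets (t vstar ptil : ℝ) (ht : 0 < t) :
    ∀ qN qNN : ℝ, Feasible t vstar ptil qN qNN →
      (∀ qN' qNN' : ℝ, Feasible t vstar ptil qN' qNN' →
        piG t ptil qN' qNN' ≤ piG t ptil qN qNN) →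
      ((-5 * (qNN - qN) ≤ ptil ∧ ptil ≤ qNN - qN ∧
          qNN = vstar - t / 2 + ((qNN - qN) - ptil) / 6) ∨
       (ptil ≤ min (qNN - qN) (-5 * (qNN - qN)) ∧ qN = vstar - t / 2) ∨
       (ptil ≥ max (qNN - qN) (-5 * (qNN - qN)) ∧ qNN = vstar - t / 2) ∨
       (qNN - qN ≤ ptil ∧ ptil ≤ -5 * (qNN - qN) ∧
          qN = vstar - t / 2 - ((qNN - qN) - ptil) / 6)) := by
  intro qN qNN hf hmax
  have shift_nonpos : ∀ d : ℝ, Feasible t vstar ptil (qN + d) (qNN + d) → d ≤ 0 := by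
    intro d hd
    have h := hmax _ _ hd
    rw [piG_add_add] at h
    linarith
  unfold Feasible at hf shift_nonpos
  simp only [add_sub_add_right_eq_sub] at shift_nonpos
  rcases le_total ptil (qNN - qN) with h | h
  · obtain ⟨hN, hNN⟩ := hf.1 h
    rcases le_total (-5 * (qNN - qN)) ptil with h5 | h5
    · refine Or.inl ⟨h5, h, le_antisymm hNN ?_⟩
      have := shift_nonpos (vstar - t / 2 + (qNN - qN - ptil) / 6 - qNN)
        ⟨fun _ => ⟨by linarith, by linarith⟩, fun _ => ⟨by linarith, by linarith⟩⟩
      linarith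
    · refine Or.inr (Or.inl ⟨le_min h h5, le_antisymm hN ?_⟩)
      have := shift_nonpos (vstar - t / 2 - qN)
        ⟨fun _ => ⟨by linarith, by linarith⟩, fun _ => ⟨by linarith, by linarith⟩⟩
      linarith
  · obtain ⟨hNN, hN⟩ := hf.2 h
    rcases le_total (-5 * (qNN - qN)) ptil with h5 | h5
    · refine Or.inr (Or.inr (Or.inl ⟨max_le h h5, le_antisymm hNN ?_⟩))
      have := shift_nonpos (vstar - t / 2 - qNN)
        ⟨fun _ => ⟨by linarith, by linarith⟩, fun _ => ⟨by linarith, by linarith⟩⟩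
      linarith
    · refine Or.inr (Or.inr (Or.inr ⟨h, h5, le_antisymm hN ?_⟩))
      have := shift_nonpos (vstar - t / 2 - (qNN - qN - ptil) / 6 - qN)
        ⟨fun _ => ⟨by linarith, by linarith⟩, fun _ => ⟨by linarith, by linarith⟩⟩
      linarith
end

section
/- Fix reals t, v*, p̃ with t > 0 and −5t/4 ≤ p̃ ≤ 0. Then the pair (q_N, q_NN) with q_N = v* − t/2 and q_NN = q_N − p̃/5 is feasible and maximizes π_G over the feasible set; in particular the optimal subscription-fee difference is Δq = −p̃/5. -/
/-- The payoff in terms of the fee difference net of the transport fee. -/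
theorem piG_eq (t ptil qN qNN : ℝ) :
    piG t ptil qN qNN =
      qN + (qNN - qN - ptil) / 2 - (qNN - qN - ptil) ^ 2 * (1 / (6 * t)) := by
  unfold piG
  ring

/-- For −5t/4 ≤ p̃ ≤ 0 the CP's optimum is q_N = v* − t/2, q_NN = q_N − p̃/5. -/
theorem cp_optimum_midneg (t vstar ptil : ℝ) (ht : 0 < t)
    (hp1 : -5 * t / 4 ≤ ptil) (hp2 : ptil ≤ 0) :
    let qN := vstar - t / 2
    let qNN := qN - ptil / 5
    Feasible t vstar ptil qN qNN ∧
    (∀ qN' qNN' : ℝ, Feasible t vstar ptil qN' qNN' →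
      piG t ptil qN' qNN' ≤ piG t ptil qN qNN) ∧
    qNN - qN = -ptil / 5 := by
  intro qN qNN
  refine ⟨⟨fun _ => ⟨le_rfl, ?_⟩, fun h => ⟨?_, ?_⟩⟩, ?_, ?_⟩
  · simp only [qNN, qN]; linarith
  · simp only [qNN, qN] at h ⊢; linarith
  · simp only [qNN, qN] at h ⊢; linarith
  · intro a b hF
    rw [piG_eq, piG_eq]
    obtain ⟨k, hk⟩ : ∃ k, k = 1 / (6 * t) := ⟨_, rfl⟩
    have hk0 : 0 < k := by rw [hk]; positivity
    have hkt : k * t = 1 / 6 := by rw [hk]; field_simp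
    rw [← hk]
    obtain ⟨d, hd⟩ : ∃ d, d = b - a - ptil := ⟨_, rfl⟩
    obtain ⟨e, he⟩ : ∃ e, e = -6 * ptil / 5 := ⟨_, rfl⟩
    have hopt : qNN - qN - ptil = e := by simp only [qNN]; linarith
    rw [hopt, ← hd]
    have he0 : 0 ≤ e := by linarith
    have hke : k * e ≤ 1 / 4 := by
      have := mul_le_mul_of_nonneg_left (show e ≤ 3 * t / 2 by linarith) hk0.le
      linarith
    rcases le_total 0 d with h | h
    · obtain ⟨h1, h2⟩ := hF.1 (by linarith)
      rcases le_total d e with hde | hde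
      · have hkd : k * d ≤ k * e := mul_le_mul_of_nonneg_left hde hk0.le
        have hprod : 0 ≤ (e - d) * (1 / 2 - k * d - k * e) :=
          mul_nonneg (by linarith) (by linarith)
        simp only [qN]
        linarith
      · have hsq : e ^ 2 * k ≤ d ^ 2 * k := by gcongr
        simp only [qN]
        linarith
    · obtain ⟨h1, h2⟩ := hF.2 (by linarith)
      have hsq : 0 ≤ d ^ 2 * k := by positivity
      have hprod : 0 ≤ e * (1 / 2 - k * e) := mul_nonneg he0 (by linarith)
      simp only [qN]
      linarith
  · simp only [qNN]; ring
end
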